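/- Let r > 0 and suppose the real coefficients (u₀,u₁,u₂,u₃,u₄;v₁,v₂,v₃,v₄) satisfy the four Villarceau-component equations. Then for every t ∈ ℝ the perturbed coefficients (u₀+t, u₁, u₂, u₃, u₄; v₁+2r²t, v₂, v₃, v₄) also satisfy the four Villarceau-component equations; moreover, the gradients of the original polynomial F and of the perturbed polynomial F_t (whose difference is t·((x²+y²+z²−r²)² + 4r²x²)) are parallel at every point of the circle Γ, so the two surfaces are smoothly blended along Γ. -/

import Mathlib

/-- The Darboux cyclide equation through the circle Γ, Lemma 3.1. -/
def cyclF (u₀ u₁ u₂ u₃ u₄ v₁ v₂ v₃ v₄ r x y z : ℝ) : ℝ :=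
  u₀*(x^2+y^2+z^2-r^2)^2 + 2*(x^2+y^2+z^2-r^2)*(u₁*x+u₂*y+u₃*z+u₄)
  + 2*x*(v₁*x+v₂*y+v₃*z+v₄)

/-- The gradient of a function ℝ³ → ℝ, as a triple of partial derivatives. -/
noncomputable def grad3 (f : ℝ → ℝ → ℝ → ℝ) (x y z : ℝ) : ℝ × ℝ × ℝ :=
  (deriv (fun t => f t y z) x, deriv (fun t => f x t z) y, deriv (fun t => f x y t) z)

/-- The cross product on ℝ × ℝ × ℝ. -/
def cross3 (a b : ℝ × ℝ × ℝ) : ℝ × ℝ × ℝ :=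
  (a.2.1*b.2.2 - a.2.2*b.2.1, a.2.2*b.1 - a.1*b.2.2, a.1*b.2.1 - a.2.1*b.1)

/-- The gradient of `cyclF` along Γ does not involve `u₀` and `v₁`. -/
theorem grad3_cyclF_of_mem_circle (u₀ u₁ u₂ u₃ u₄ v₁ v₂ v₃ v₄ r y z : ℝ)
    (h : y^2 + z^2 = r^2) :
    grad3 (cyclF u₀ u₁ u₂ u₃ u₄ v₁ v₂ v₃ v₄ r) 0 y z =
      (2*(v₂*y+v₃*z+v₄), 4*y*(u₂*y+u₃*z+u₄), 4*z*(u₂*y+u₃*z+u₄)) := by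
  have hid (a : ℝ) : HasDerivAt (fun s : ℝ => s) 1 a := hasDerivAt_id' a
  have hx : HasDerivAt (fun s => cyclF u₀ u₁ u₂ u₃ u₄ v₁ v₂ v₃ v₄ r s y z)
      (2*(v₂*y+v₃*z+v₄)) 0 := by
    have hq := ((((hid 0).fun_pow 2).add_const (y^2)).add_const (z^2)).sub_const (r^2)
    have hL := ((((hid 0).const_mul u₁).add_const (u₂*y)).add_const (u₃*z)).add_const u₄
    have hM := ((((hid 0).const_mul v₁).add_const (v₂*y)).add_const (v₃*z)).add_const v₄
    refine ((((hq.fun_pow 2).const_mul u₀).fun_add ((hq.const_mul 2).fun_mul hL)).fun_add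
      (((hid 0).const_mul 2).fun_mul hM)).congr_deriv ?_
    simp only [← h, Nat.cast_ofNat, Nat.reduceSub]
    ring
  have hy : HasDerivAt (fun s => cyclF u₀ u₁ u₂ u₃ u₄ v₁ v₂ v₃ v₄ r 0 s z)
      (4*y*(u₂*y+u₃*z+u₄)) y := by
    have hq := ((((hid y).fun_pow 2).const_add (0^2)).add_const (z^2)).sub_const (r^2)
    have hL := ((((hid y).const_mul u₂).const_add (u₁*0)).add_const (u₃*z)).add_const u₄
    have hM := ((((hid y).const_mul v₂).const_add (v₁*0)).add_const (v₃*z)).add_const v₄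
    refine ((((hq.fun_pow 2).const_mul u₀).fun_add ((hq.const_mul 2).fun_mul hL)).fun_add
      (hM.const_mul (2*0))).congr_deriv ?_
    simp only [← h, Nat.cast_ofNat, Nat.reduceSub]
    ring
  have hz : HasDerivAt (fun s => cyclF u₀ u₁ u₂ u₃ u₄ v₁ v₂ v₃ v₄ r 0 y s)
      (4*z*(u₂*y+u₃*z+u₄)) z := by
    have hq := (((hid z).fun_pow 2).const_add (0^2+y^2)).sub_const (r^2)
    have hL := (((hid z).const_mul u₃).const_add (u₁*0+u₂*y)).add_const u₄
    have hM := (((hid z).const_mul v₃).const_add (v₁*0+v₂*y)).add_const v₄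
    refine ((((hq.fun_pow 2).const_mul u₀).fun_add ((hq.const_mul 2).fun_mul hL)).fun_add
      (hM.const_mul (2*0))).congr_deriv ?_
    simp only [← h, Nat.cast_ofNat, Nat.reduceSub]
    ring
  simp only [grad3, hx.deriv, hy.deriv, hz.deriv]

/-- Proposition 6.9 (first part): if the coefficients satisfy the four
Villarceau-component equations, then for every t the coefficients perturbed by
t·((x²+y²+z²−r²)² + 4r²x²) also satisfy them, and the two surfaces are smoothly
blended along Γ (parallel gradients at every point of Γ). -/
theorem stmt11 (r u₀ u₁ u₂ u₃ u₄ v₁ v₂ v₃ v₄ : ℝ) (hr : 0 < r)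
    (h1 : v₄ - 2*r^2*u₁ = 0) (h2 : v₁ + 2*u₄ - 2*r^2*u₀ = 0)
    (h3 : u₂*v₂ + u₃*v₃ - 2*u₁*u₄ = 0)
    (h4 : 4*r^2*(u₁^2+u₂^2+u₃^2) - 4*u₄^2 - v₂^2 - v₃^2 = 0)
    (t : ℝ) :
    -- the perturbed coefficients satisfy the Villarceau-component equations
    (v₄ - 2*r^2*u₁ = 0 ∧ (v₁+2*r^2*t) + 2*u₄ - 2*r^2*(u₀+t) = 0 ∧
      u₂*v₂ + u₃*v₃ - 2*u₁*u₄ = 0 ∧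
      4*r^2*(u₁^2+u₂^2+u₃^2) - 4*u₄^2 - v₂^2 - v₃^2 = 0)
    -- the difference of the two polynomials is t·((x²+y²+z²−r²)² + 4r²x²)
    ∧ (∀ x y z : ℝ,
      cyclF (u₀+t) u₁ u₂ u₃ u₄ (v₁+2*r^2*t) v₂ v₃ v₄ r x y z
        - cyclF u₀ u₁ u₂ u₃ u₄ v₁ v₂ v₃ v₄ r x y z
        = t*((x^2+y^2+z^2-r^2)^2 + 4*r^2*x^2))
    -- the gradients are parallel at every point of Γ
    ∧ (∀ y z : ℝ, y^2 + z^2 = r^2 →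
      cross3 (grad3 (cyclF u₀ u₁ u₂ u₃ u₄ v₁ v₂ v₃ v₄ r) 0 y z)
             (grad3 (cyclF (u₀+t) u₁ u₂ u₃ u₄ (v₁+2*r^2*t) v₂ v₃ v₄ r) 0 y z)
        = (0, 0, 0)) := by
  refine ⟨⟨h1, by linarith, h3, h4⟩, fun x y z => ?_, fun y z h => ?_⟩
  · simp only [cyclF]
    ring
  · rw [grad3_cyclF_of_mem_circle _ _ _ _ _ _ _ _ _ _ _ _ h,
      grad3_cyclF_of_mem_circle _ _ _ _ _ _ _ _ _ _ _ _ h]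
    simp only [cross3, Prod.mk.injEq]
    refine ⟨?_, ?_, ?_⟩ <;> ring
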